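/- Let F : ℂ → ℍ be an injective ℝ-linear map. Then F is conformal, i.e. there exists λ > 0 such that ⟨F x, F y⟩_ℝ = λ·⟨x, y⟩ for all x, y ∈ ℂ (where ⟨x, y⟩ is the real inner product Re(x̄ y) on ℂ ≅ ℝ²), if and only if there exist N, R ∈ ℍ with N² = −1 = R² such that F(i x) = N·F(x) = −F(x)·R for all x ∈ ℂ. -/

import Mathlib

/-- A real quaternion squares to `-1` iff it is purely imaginary of norm one. -/
theorem Quaternion.sq_eq_neg_one_iff (q : Quaternion ℝ) :
    q ^ 2 = -1 ↔ q.re = 0 ∧ Quaternion.normSq q = 1 := by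
  rw [Quaternion.normSq_def', Quaternion.ext_iff]
  simp only [sq, Quaternion.re_mul, Quaternion.imI_mul, Quaternion.imJ_mul, Quaternion.imK_mul,
    Quaternion.re_neg, Quaternion.imI_neg, Quaternion.imJ_neg, Quaternion.imK_neg,
    Quaternion.re_one, Quaternion.imI_one, Quaternion.imJ_one, Quaternion.imK_one]
  constructor
  · rintro ⟨h, hi, hj, hk⟩
    have hre : q.re = 0 := by
      by_contra hne
      have hi' : q.imI = 0 := mul_left_cancel₀ hne (by linarith)
      have hj' : q.imJ = 0 := mul_left_cancel₀ hne (by linarith)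
      have hk' : q.imK = 0 := mul_left_cancel₀ hne (by linarith)
      rw [hi', hj', hk'] at h
      nlinarith [mul_self_nonneg q.re]
    refine ⟨hre, ?_⟩
    rw [hre] at h ⊢
    linarith
  · rintro ⟨hre, h⟩
    rw [hre] at h ⊢
    refine ⟨?_, ?_, ?_, ?_⟩ <;> linarith

/-- The real part of a product of quaternions is invariant under swapping the factors. -/
theorem Quaternion.re_mul_comm (p q : Quaternion ℝ) : (p * q).re = (q * p).re := by
  simp only [Quaternion.re_mul]
  ring

/-- A real-linear map on `ℂ` is determined by its values at `1` and `I`. -/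
theorem Complex.linearMap_apply_eq {M : Type*} [AddCommGroup M] [Module ℝ M] (F : ℂ →ₗ[ℝ] M)
    (x : ℂ) : F x = x.re • F 1 + x.im • F Complex.I := by
  rw [← map_smul, ← map_smul, ← map_add]
  congr 1
  apply Complex.ext <;> simp

/-- If `F` is real-linear on `ℂ` and `T` is a linear map sending `F 1` to `F I` and `F I` to
`-F 1`, then `T` intertwines multiplication by `I`. -/
theorem Complex.linearMap_I_mul {M : Type*} [AddCommGroup M] [Module ℝ M] (F : ℂ →ₗ[ℝ] M)
    (T : M →ₗ[ℝ] M) (h₁ : T (F 1) = F Complex.I) (hI : T (F Complex.I) = -F 1) (x : ℂ) :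
    F (Complex.I * x) = T (F x) := by
  rw [Complex.linearMap_apply_eq F x, Complex.linearMap_apply_eq F (Complex.I * x), map_add,
    map_smul, map_smul, h₁, hI]
  simp [add_comm]

/-- An injective ℝ-linear map `F : ℂ → ℍ` is conformal (for the Euclidean inner
products) iff there exist `N, R ∈ ℍ` with `N² = -1 = R²` such that
`F(ix) = N·F(x) = -F(x)·R` for all `x`. -/
theorem conformal_iff_exists_normal_vectors (F : ℂ →ₗ[ℝ] Quaternion ℝ)
    (hF : Function.Injective F) :
    (∃ c : ℝ, 0 < c ∧ ∀ x y : ℂ,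
        (star (F x) * F y).re = c * ((starRingEnd ℂ) x * y).re) ↔
    (∃ N R : Quaternion ℝ, N ^ 2 = -1 ∧ R ^ 2 = -1 ∧
        ∀ x : ℂ, F (Complex.I * x) = N * F x ∧ N * F x = -(F x * R)) := by
  have ha : F 1 ≠ 0 := fun h => one_ne_zero (hF (h.trans (map_zero F).symm))
  have hpos : 0 < Quaternion.normSq (F 1) :=
    lt_of_le_of_ne Quaternion.normSq_nonneg (Quaternion.normSq_ne_zero.mpr ha).symm
  constructor
  · rintro ⟨c, -, h⟩
    have h11 := h 1 1
    have hII := h Complex.I Complex.I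
    have h1I := h 1 Complex.I
    rw [Quaternion.star_mul_self, Quaternion.re_coe] at h11 hII
    simp only [map_one, mul_one, Complex.one_re, one_mul, Complex.I_re, mul_zero, Complex.conj_I,
      neg_mul, Complex.I_mul_I, neg_neg] at h11 hII h1I
    have hnorm : Quaternion.normSq (F Complex.I) = Quaternion.normSq (F 1) := hII.trans h11.symm
    have hN : (F Complex.I * (F 1)⁻¹) ^ 2 = -1 := by
      rw [Quaternion.sq_eq_neg_one_iff]
      constructor
      · rw [Quaternion.re_mul_comm, Quaternion.inv_def, smul_mul_assoc, Quaternion.re_smul,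
          h1I, smul_zero]
      · rw [map_mul, map_inv₀, hnorm, mul_inv_cancel₀ hpos.ne']
    have hR : (-((F 1)⁻¹ * F Complex.I)) ^ 2 = -1 := by
      rw [neg_sq, Quaternion.sq_eq_neg_one_iff]
      constructor
      · rw [Quaternion.inv_def, smul_mul_assoc, Quaternion.re_smul, h1I, smul_zero]
      · rw [map_mul, map_inv₀, hnorm, inv_mul_cancel₀ hpos.ne']
    refine ⟨_, _, hN, hR, fun x => ?_⟩
    have hleft := Complex.linearMap_I_mul F (LinearMap.mulLeft ℝ (F Complex.I * (F 1)⁻¹))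
      (by simp [ha])
      (by
        rw [LinearMap.mulLeft_apply]
        calc _ = (F Complex.I * (F 1)⁻¹) ^ 2 * F 1 := by simp [sq, mul_assoc, ha]
          _ = _ := by rw [hN, neg_one_mul]) x
    have hright := Complex.linearMap_I_mul F (LinearMap.mulRight ℝ ((F 1)⁻¹ * F Complex.I))
      (by simp [ha])
      (by
        rw [LinearMap.mulRight_apply]
        calc _ = F 1 * (-((F 1)⁻¹ * F Complex.I)) ^ 2 := by simp [sq, ← mul_assoc, ha]
          _ = _ := by rw [hR, mul_neg_one]) x
    rw [LinearMap.mulLeft_apply] at hleft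
    rw [LinearMap.mulRight_apply] at hright
    exact ⟨hleft, by rw [← hleft, hright, mul_neg, neg_neg]⟩
  · rintro ⟨N, R, hN, -, h⟩
    obtain ⟨hre, hnorm⟩ := (Quaternion.sq_eq_neg_one_iff N).mp hN
    have hI : F Complex.I = N * F 1 := by simpa using (h 1).1
    have hII : (star (F Complex.I) * F Complex.I).re = Quaternion.normSq (F 1) := by
      rw [Quaternion.star_mul_self, Quaternion.re_coe, hI, map_mul, hnorm, one_mul]
    have h11 : (star (F 1) * F 1).re = Quaternion.normSq (F 1) := by
      rw [Quaternion.star_mul_self, Quaternion.re_coe]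
    have h1I : (star (F 1) * F Complex.I).re = 0 := by
      rw [hI, Quaternion.re_mul_comm, mul_assoc, Quaternion.self_mul_star,
        Quaternion.mul_coe_eq_smul, Quaternion.re_smul, hre, smul_zero]
    have hI1 : (star (F Complex.I) * F 1).re = 0 := by
      refine Eq.trans ?_ h1I
      rw [← Quaternion.re_star (star (F 1) * F Complex.I), star_mul, star_star]
    refine ⟨_, hpos, fun x y => ?_⟩
    rw [Complex.linearMap_apply_eq F x, Complex.linearMap_apply_eq F y]
    simp only [star_add, Quaternion.star_smul, add_mul, mul_add, smul_mul_assoc, mul_smul_comm,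
      Quaternion.re_add, Quaternion.re_smul, h11, hII, h1I, hI1, smul_eq_mul, Complex.mul_re,
      Complex.conj_re, Complex.conj_im]
    ring
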